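/- arXiv:2403.08145 — 2 statements merged into one kernel-verified Lean document; each statement's English description precedes it below -/
import Mathlib

section
/- Let ε ∈ (0, 1), let n, m be positive integers, and let G = {kε : k ∈ ℕ, kε ≤ ε^{-1}}. Let X_1, X_2 be independent random variables taking values in G, and let X_1', X_2' be independent random variables taking values in G, such that for every x ∈ G with x > 0 and each i ∈ {1, 2}: P(X_i' = x) ≤ P(X_i = x) ≤ P(X_i' = x) + ε^4/(nm). Then E[max(X_1, X_2)] − 2ε/n ≤ E[max(X_1', X_2')] ≤ E[max(X_1, X_2)]. -/
open MeasureTheory ProbabilityTheory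

/-- The grid `G = {kε : k ∈ ℕ, kε ≤ ε⁻¹}`. -/
def grid (ε : ℝ) : Set ℝ := {x | ∃ k : ℕ, x = (k : ℝ) * ε ∧ (k : ℝ) * ε ≤ ε⁻¹}

/-- If `p'` arises from `p` by moving at most `δ` of the mass of every positive index to the
index `0`, then the mean of a function whose increments from `0` lie in `[0, c]` drops by at
most `K * (δ * c)`. -/
lemma sum_mul_sub_sum_mul_mem_Icc {K : ℕ} {p p' f : ℕ → ℝ} {δ c : ℝ} (hδ : 0 ≤ δ)
    (hsum : ∑ k ∈ Finset.range (K + 1), p k = ∑ k ∈ Finset.range (K + 1), p' k)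
    (hp : ∀ k ≤ K, 0 < k → p' k ≤ p k ∧ p k ≤ p' k + δ)
    (hf : ∀ k ≤ K, f 0 ≤ f k ∧ f k ≤ f 0 + c) :
    (∑ k ∈ Finset.range (K + 1), p k * f k) - ∑ k ∈ Finset.range (K + 1), p' k * f k ∈
      Set.Icc 0 (K * (δ * c)) := by
  have hdiff : (∑ k ∈ Finset.range (K + 1), p k * f k)
      - ∑ k ∈ Finset.range (K + 1), p' k * f k
      = ∑ k ∈ Finset.range K, (p (k + 1) - p' (k + 1)) * (f (k + 1) - f 0) := by
    have hexp : ∑ k ∈ Finset.range (K + 1), (p k - p' k) * (f k - f 0)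
        = (∑ k ∈ Finset.range (K + 1), p k * f k)
          - ∑ k ∈ Finset.range (K + 1), p' k * f k := by
      simp only [sub_mul, mul_sub, Finset.sum_sub_distrib, ← Finset.sum_mul, hsum]
      ring
    rw [← hexp, Finset.sum_range_succ']
    simp
  rw [hdiff]
  have hmem : ∀ k ∈ Finset.range K, (p (k + 1) - p' (k + 1)) * (f (k + 1) - f 0) ∈
      Set.Icc 0 (δ * c) := by
    intro k hk
    have hk' : k + 1 ≤ K := Finset.mem_range.mp hk
    obtain ⟨h1, h2⟩ := hp (k + 1) hk' k.succ_pos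
    obtain ⟨h3, h4⟩ := hf (k + 1) hk'
    exact ⟨mul_nonneg (by linarith) (by linarith),
      mul_le_mul (by linarith) (by linarith) (by linarith) hδ⟩
  refine ⟨Finset.sum_nonneg fun k hk => (hmem k hk).1, ?_⟩
  simpa using Finset.sum_le_card_nsmul _ _ _ fun k hk => (hmem k hk).2

/-- The mean of `k ↦ max (k * ε) y` against probability weights exceeds its value at `y = 0` by at
most `y`. -/
lemma sum_mul_max_mem_Icc {K : ℕ} {q : ℕ → ℝ} {ε y c : ℝ} (hε : 0 ≤ ε) (hq : ∀ k, 0 ≤ q k)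
    (hsum : ∑ k ∈ Finset.range (K + 1), q k = 1) (hy : 0 ≤ y) (hyc : y ≤ c) :
    ∑ k ∈ Finset.range (K + 1), q k * max (k * ε) 0
        ≤ ∑ k ∈ Finset.range (K + 1), q k * max (k * ε) y ∧
      ∑ k ∈ Finset.range (K + 1), q k * max (k * ε) y
        ≤ (∑ k ∈ Finset.range (K + 1), q k * max (k * ε) 0) + c := by
  constructor
  · exact Finset.sum_le_sum fun k _ => mul_le_mul_of_nonneg_left (max_le_max_left _ hy) (hq k)
  · calc ∑ k ∈ Finset.range (K + 1), q k * max (k * ε) y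
        ≤ ∑ k ∈ Finset.range (K + 1), (q k * max (k * ε) 0 + q k * c) := by
          refine Finset.sum_le_sum fun k _ => ?_
          rw [← mul_add]
          refine mul_le_mul_of_nonneg_left ?_ (hq k)
          have hk : 0 ≤ (k : ℝ) * ε := by positivity
          rw [max_eq_left hk]
          exact max_le (by linarith) (by linarith)
      _ = _ := by rw [Finset.sum_add_distrib, ← Finset.sum_mul, hsum, one_mul]

lemma mem_grid_iff_exists_le_floor {ε x : ℝ} (hε : 0 < ε) :
    x ∈ grid ε ↔ ∃ k ≤ ⌊ε⁻¹ / ε⌋₊, x = (k : ℝ) * ε := by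
  have h (k : ℕ) : k ≤ ⌊ε⁻¹ / ε⌋₊ ↔ (k : ℝ) * ε ≤ ε⁻¹ := by
    rw [Nat.le_floor_iff (by positivity), le_div_iff₀ hε]
  simp only [grid, Set.mem_ofPred_eq, h, and_comm]

section Expectation

variable {Ω : Type*} [MeasurableSpace Ω] {P : Measure Ω} [IsProbabilityMeasure P]

/-- The mean of a function of two random variables with values in `{k * ε | k ≤ K}`. -/
lemma integral_eq_sum_sum_measureReal {ε : ℝ} (hε : 0 < ε) {K : ℕ} {X Y : Ω → ℝ}
    (hX : Measurable X) (hY : Measurable Y)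
    (hvX : ∀ ω, ∃ k ≤ K, X ω = (k : ℝ) * ε) (hvY : ∀ ω, ∃ k ≤ K, Y ω = (k : ℝ) * ε)
    (g : ℝ → ℝ → ℝ) :
    ∫ ω, g (X ω) (Y ω) ∂P = ∑ i ∈ Finset.range (K + 1), ∑ j ∈ Finset.range (K + 1),
      P.real (X ⁻¹' {(i : ℝ) * ε} ∩ Y ⁻¹' {(j : ℝ) * ε}) * g (i * ε) (j * ε) := by
  have hms (i j : ℕ) : MeasurableSet (X ⁻¹' {(i : ℝ) * ε} ∩ Y ⁻¹' {(j : ℝ) * ε}) :=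
    (hX (measurableSet_singleton _)).inter (hY (measurableSet_singleton _))
  have hpt (ω : Ω) : g (X ω) (Y ω) = ∑ i ∈ Finset.range (K + 1), ∑ j ∈ Finset.range (K + 1),
      (X ⁻¹' {(i : ℝ) * ε} ∩ Y ⁻¹' {(j : ℝ) * ε}).indicator
        (fun _ => g (i * ε) (j * ε)) ω := by
    obtain ⟨a, ha, hXa⟩ := hvX ω
    obtain ⟨b, hb, hYb⟩ := hvY ω
    rw [Finset.sum_eq_single_of_mem a (by simpa [Nat.lt_succ_iff] using ha),
      Finset.sum_eq_single_of_mem b (by simpa [Nat.lt_succ_iff] using hb)]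
    · simp [hXa, hYb]
    · intro j _ hj
      simp [hYb, hε.ne', hj.symm]
    · intro i _ hi
      simp [hXa, hε.ne', hi.symm]
  have hint (i j : ℕ) : Integrable ((X ⁻¹' {(i : ℝ) * ε} ∩ Y ⁻¹' {(j : ℝ) * ε}).indicator
      (fun _ => g (i * ε) (j * ε))) P := (integrable_const _).indicator (hms i j)
  simp_rw [hpt]
  rw [integral_finsetSum _ fun i _ => integrable_finsetSum _ fun j _ => hint i j]
  refine Finset.sum_congr rfl fun i _ => ?_
  rw [integral_finsetSum _ fun j _ => hint i j]
  refine Finset.sum_congr rfl fun j _ => ?_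
  rw [integral_indicator_const _ (hms i j), smul_eq_mul]

lemma sum_measureReal_preimage_eq_one {ε : ℝ} (hε : 0 < ε) {K : ℕ} {X : Ω → ℝ}
    (hX : Measurable X) (hvX : ∀ ω, ∃ k ≤ K, X ω = (k : ℝ) * ε) :
    ∑ k ∈ Finset.range (K + 1), P.real (X ⁻¹' {(k : ℝ) * ε}) = 1 := by
  rw [← measureReal_biUnion_finset]
  · convert probReal_univ (μ := P)
    ext ω
    obtain ⟨k, hk, h⟩ := hvX ω
    simpa using ⟨k, by omega, h⟩
  · intro i _ j _ hij
    refine Disjoint.preimage X ?_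
    simpa [hε.ne'] using hij
  · exact fun k _ => hX (measurableSet_singleton _)

lemma ProbabilityTheory.IndepFun.integral_max_eq_sum {ε : ℝ} (hε : 0 < ε) {K : ℕ} {X Y : Ω → ℝ}
    (hXY : IndepFun X Y P) (hX : Measurable X) (hY : Measurable Y)
    (hvX : ∀ ω, ∃ k ≤ K, X ω = (k : ℝ) * ε) (hvY : ∀ ω, ∃ k ≤ K, Y ω = (k : ℝ) * ε) :
    ∫ ω, max (X ω) (Y ω) ∂P = ∑ i ∈ Finset.range (K + 1), P.real (X ⁻¹' {(i : ℝ) * ε}) *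
      ∑ j ∈ Finset.range (K + 1), P.real (Y ⁻¹' {(j : ℝ) * ε}) * max (j * ε) (i * ε) := by
  rw [integral_eq_sum_sum_measureReal hε hX hY hvX hvY max]
  refine Finset.sum_congr rfl fun i _ => ?_
  rw [Finset.mul_sum]
  refine Finset.sum_congr rfl fun j _ => ?_
  rw [measureReal_def, hXY.measure_inter_preimage_eq_mul _ _ (measurableSet_singleton _)
    (measurableSet_singleton _), ENNReal.toReal_mul, max_comm, mul_assoc]
  rfl

end Expectation

/-- Let `ε ∈ (0,1)`, `n, m` positive integers, `X₁, X₂` independent random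
variables with values in the grid `G`, and `X₁', X₂'` independent random variables with
values in `G` such that for every positive `x ∈ G` and `i ∈ {1,2}`,
`P(Xᵢ' = x) ≤ P(Xᵢ = x) ≤ P(Xᵢ' = x) + ε⁴/(nm)`. Then
`E[max(X₁,X₂)] − 2ε/n ≤ E[max(X₁',X₂')] ≤ E[max(X₁,X₂)]`. -/
theorem rounded_pair_max_expectation_bounds
    {Ω : Type*} [MeasurableSpace Ω] (P : Measure Ω) [IsProbabilityMeasure P]
    (ε : ℝ) (hε0 : 0 < ε) (hε1 : ε < 1)
    (n m : ℕ) (hn : 0 < n) (hm : 0 < m)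
    (X₁ X₂ X₁' X₂' : Ω → ℝ)
    (hm1 : Measurable X₁) (hm2 : Measurable X₂)
    (hm1' : Measurable X₁') (hm2' : Measurable X₂')
    (hv1 : ∀ ω, X₁ ω ∈ grid ε) (hv2 : ∀ ω, X₂ ω ∈ grid ε)
    (hv1' : ∀ ω, X₁' ω ∈ grid ε) (hv2' : ∀ ω, X₂' ω ∈ grid ε)
    (hind : IndepFun X₁ X₂ P) (hind' : IndepFun X₁' X₂' P)
    (hpmf1 : ∀ x ∈ grid ε, 0 < x →
      (P {ω | X₁' ω = x}).toReal ≤ (P {ω | X₁ ω = x}).toReal ∧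
      (P {ω | X₁ ω = x}).toReal ≤ (P {ω | X₁' ω = x}).toReal + ε ^ 4 / ((n : ℝ) * m))
    (hpmf2 : ∀ x ∈ grid ε, 0 < x →
      (P {ω | X₂' ω = x}).toReal ≤ (P {ω | X₂ ω = x}).toReal ∧
      (P {ω | X₂ ω = x}).toReal ≤ (P {ω | X₂' ω = x}).toReal + ε ^ 4 / ((n : ℝ) * m)) :
    (∫ ω, max (X₁ ω) (X₂ ω) ∂P) - 2 * ε / n ≤ ∫ ω, max (X₁' ω) (X₂' ω) ∂P ∧
    (∫ ω, max (X₁' ω) (X₂' ω) ∂P) ≤ ∫ ω, max (X₁ ω) (X₂ ω) ∂P := by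
  set K := ⌊ε⁻¹ / ε⌋₊ with hK
  set δ := ε ^ 4 / ((n : ℝ) * m) with hδ
  have hn' : (1 : ℝ) ≤ n := by exact_mod_cast hn
  have hm' : (1 : ℝ) ≤ m := by exact_mod_cast hm
  have hδ0 : 0 ≤ δ := by positivity
  have hbound : K * (δ * (K * ε)) ≤ ε / n := by
    have hKε : (K : ℝ) * ε ^ 2 ≤ 1 := by
      calc (K : ℝ) * ε ^ 2 ≤ ε⁻¹ / ε * ε ^ 2 := by
            gcongr
            exact Nat.floor_le (by positivity)
        _ = 1 := by field_simp
    have hδn : δ ≤ ε ^ 4 / n := by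
      rw [hδ]
      gcongr
      nlinarith
    calc K * (δ * (K * ε)) ≤ K * (ε ^ 4 / n * (K * ε)) := by gcongr
      _ = (K * ε ^ 2) ^ 2 * (ε / n) := by ring
      _ ≤ 1 * (ε / n) := by
          gcongr
          exact pow_le_one₀ (by positivity) hKε
      _ = ε / n := one_mul _
  simp only [mem_grid_iff_exists_le_floor hε0, ← hK] at hv1 hv2 hv1' hv2'
  have hgrid (k : ℕ) (hk : k ≤ K) : (k : ℝ) * ε ∈ grid ε :=
    (mem_grid_iff_exists_le_floor hε0).2 ⟨k, hk, rfl⟩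
  rw [hind.integral_max_eq_sum hε0 hm1 hm2 hv1 hv2,
    hind'.integral_max_eq_sum hε0 hm1' hm2' hv1' hv2']
  have hs1 := sum_measureReal_preimage_eq_one (P := P) hε0 hm1 hv1
  have hs2 := sum_measureReal_preimage_eq_one (P := P) hε0 hm2 hv2
  have hs1' := sum_measureReal_preimage_eq_one (P := P) hε0 hm1' hv1'
  have hs2' := sum_measureReal_preimage_eq_one (P := P) hε0 hm2' hv2'
  have hq1 (k : ℕ) (hk : k ≤ K) (hk0 : 0 < k) := hpmf1 (k * ε) (hgrid k hk) (by positivity)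
  have hq2 (k : ℕ) (hk : k ≤ K) (hk0 : 0 < k) := hpmf2 (k * ε) (hgrid k hk) (by positivity)
  have hle (k : ℕ) (hk : k ≤ K) : (k : ℝ) * ε ≤ K * ε := by gcongr
  have hstep1 := sum_mul_sub_sum_mul_mem_Icc (K := K) (c := K * ε)
    (p := fun i => P.real (X₁ ⁻¹' {(i : ℝ) * ε})) (p' := fun i => P.real (X₁' ⁻¹' {(i : ℝ) * ε}))
    (f := fun i => ∑ j ∈ Finset.range (K + 1),
      P.real (X₂ ⁻¹' {(j : ℝ) * ε}) * max (j * ε) (i * ε))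
    hδ0 (hs1.trans hs1'.symm) hq1 fun k hk => by
      simpa using sum_mul_max_mem_Icc hε0.le (fun _ => measureReal_nonneg) hs2
        (y := k * ε) (by positivity) (hle k hk)
  have hstep2 := sum_mul_sub_sum_mul_mem_Icc (K := K) (c := K * ε)
    (p := fun i => P.real (X₂ ⁻¹' {(i : ℝ) * ε})) (p' := fun i => P.real (X₂' ⁻¹' {(i : ℝ) * ε}))
    (f := fun i => ∑ j ∈ Finset.range (K + 1),
      P.real (X₁' ⁻¹' {(j : ℝ) * ε}) * max (j * ε) (i * ε))
    hδ0 (hs2.trans hs2'.symm) hq2 fun k hk => by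
      simpa using sum_mul_max_mem_Icc hε0.le (fun _ => measureReal_nonneg) hs1'
        (y := k * ε) (by positivity) (hle k hk)
  have hswap (p q : ℕ → ℝ) :
      ∑ i ∈ Finset.range (K + 1), p i * ∑ j ∈ Finset.range (K + 1), q j * max (j * ε) (i * ε)
      = ∑ j ∈ Finset.range (K + 1), q j *
        ∑ i ∈ Finset.range (K + 1), p i * max (i * ε) (j * ε) := by
    simp only [Finset.mul_sum]
    rw [Finset.sum_comm]
    refine Finset.sum_congr rfl fun j _ => Finset.sum_congr rfl fun i _ => ?_
    rw [max_comm]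
    ring
  rw [hswap (fun i => P.real (X₂ ⁻¹' {(i : ℝ) * ε})),
    hswap (fun i => P.real (X₂' ⁻¹' {(i : ℝ) * ε}))] at hstep2
  have htwo : 2 * ε / n = ε / n + ε / n := by ring
  obtain ⟨h1, h2⟩ := hstep1
  obtain ⟨h3, h4⟩ := hstep2
  exact ⟨by linarith, by linarith⟩
end

section
/- Let S be a finite set of nonnegative reals, let δ ≥ 0, let X_1, X_2 be independent random variables taking values in S, and let X_1', X_2' be independent random variables taking values in S, such that for every x ∈ S with x > 0 and each i ∈ {1, 2}: P(X_i' = x) ≤ P(X_i = x) ≤ P(X_i' = x) + δ. Then for every x ∈ S with x > 0: P(max(X_1', X_2') = x) ≥ P(max(X_1, X_2) = x) − 2δ. -/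
open MeasureTheory ProbabilityTheory

/-- If `X` and `Y` take values in a finite set `S` and every atom of `Y` in `A` has at most the
probability it has under `X`, then `Y` avoids `A` at least as often as `X` does. -/
lemma measureReal_preimage_compl_le_of_atoms_le
    {Ω : Type*} [MeasurableSpace Ω] {P : Measure Ω} [IsProbabilityMeasure P]
    {S : Finset ℝ} {X Y : Ω → ℝ} (hX : Measurable X) (hY : Measurable Y)
    (hXS : ∀ ω, X ω ∈ S) (hYS : ∀ ω, Y ω ∈ S) {A : Set ℝ} (hA : MeasurableSet A)
    (h : ∀ x ∈ S, x ∈ A → P.real (Y ⁻¹' {x}) ≤ P.real (X ⁻¹' {x})) :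
    P.real (X ⁻¹' Aᶜ) ≤ P.real (Y ⁻¹' Aᶜ) := by
  classical
  have sum_atoms : ∀ Z : Ω → ℝ, Measurable Z → (∀ ω, Z ω ∈ S) →
      P.real (Z ⁻¹' A) = ∑ x ∈ S with x ∈ A, P.real (Z ⁻¹' {x}) := by
    intro Z hZ hZS
    rw [sum_measureReal_preimage_singleton _ fun x _ => hZ (measurableSet_singleton x)]
    congr 1
    ext ω
    simp [hZS ω]
  rw [Set.preimage_compl, Set.preimage_compl, probReal_compl_eq_one_sub (hX hA),
    probReal_compl_eq_one_sub (hY hA), sum_atoms X hX hXS, sum_atoms Y hY hYS]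
  refine sub_le_sub_left (Finset.sum_le_sum fun x hx => ?_) 1
  rw [Finset.mem_filter] at hx
  exact h x hx.1 hx.2

/-- The probability that the maximum of two independent real random variables equals `x`. -/
lemma ProbabilityTheory.IndepFun.measureReal_max_eq
    {Ω : Type*} [MeasurableSpace Ω] {P : Measure Ω} [IsFiniteMeasure P]
    {X Y : Ω → ℝ} (h : IndepFun X Y P) (hX : Measurable X) (hY : Measurable Y) (x : ℝ) :
    P.real {ω | max (X ω) (Y ω) = x} =
      P.real (X ⁻¹' {x}) * P.real (Y ⁻¹' Set.Iic x) +
        P.real (X ⁻¹' Set.Iio x) * P.real (Y ⁻¹' {x}) := by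
  have hsplit : {ω | max (X ω) (Y ω) = x} =
      (X ⁻¹' {x} ∩ Y ⁻¹' Set.Iic x) ∪ (X ⁻¹' Set.Iio x ∩ Y ⁻¹' {x}) := by
    ext ω
    simp only [Set.mem_ofPred_eq, Set.mem_union, Set.mem_inter_iff, Set.mem_preimage,
      Set.mem_singleton_iff, Set.mem_Iic, Set.mem_Iio]
    grind
  have hdisj : Disjoint (X ⁻¹' {x} ∩ Y ⁻¹' Set.Iic x) (X ⁻¹' Set.Iio x ∩ Y ⁻¹' {x}) := by
    rw [Set.disjoint_left]
    rintro ω ⟨h1, -⟩ ⟨h2, -⟩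
    exact (Set.mem_Iio.1 h2).ne h1
  rw [hsplit, measureReal_union hdisj
    ((hX measurableSet_Iio).inter (hY (measurableSet_singleton x)))]
  simp only [measureReal_def, ← ENNReal.toReal_mul]
  rw [h.measure_inter_preimage_eq_mul _ _ (measurableSet_singleton x) measurableSet_Iic,
    h.measure_inter_preimage_eq_mul _ _ measurableSet_Iio (measurableSet_singleton x)]

/-- Let `S` be a finite set of nonnegative reals, `δ ≥ 0`, `X₁, X₂`
independent random variables with values in `S`, and `X₁', X₂'` independent random
variables with values in `S`, such that for every positive `x ∈ S` and `i ∈ {1,2}`,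
`P(Xᵢ' = x) ≤ P(Xᵢ = x) ≤ P(Xᵢ' = x) + δ`. Then for every positive `x ∈ S`,
`P(max(X₁',X₂') = x) ≥ P(max(X₁,X₂) = x) − 2δ`. -/
theorem rounded_pair_max_pointwise_bound
    {Ω : Type*} [MeasurableSpace Ω] (P : Measure Ω) [IsProbabilityMeasure P]
    (S : Finset ℝ) (hS : ∀ x ∈ S, 0 ≤ x) (δ : ℝ) (hδ : 0 ≤ δ)
    (X₁ X₂ X₁' X₂' : Ω → ℝ)
    (hm1 : Measurable X₁) (hm2 : Measurable X₂)
    (hm1' : Measurable X₁') (hm2' : Measurable X₂')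
    (hv1 : ∀ ω, X₁ ω ∈ S) (hv2 : ∀ ω, X₂ ω ∈ S)
    (hv1' : ∀ ω, X₁' ω ∈ S) (hv2' : ∀ ω, X₂' ω ∈ S)
    (hind : IndepFun X₁ X₂ P) (hind' : IndepFun X₁' X₂' P)
    (hpmf1 : ∀ x ∈ S, 0 < x →
      (P {ω | X₁' ω = x}).toReal ≤ (P {ω | X₁ ω = x}).toReal ∧
      (P {ω | X₁ ω = x}).toReal ≤ (P {ω | X₁' ω = x}).toReal + δ)
    (hpmf2 : ∀ x ∈ S, 0 < x →
      (P {ω | X₂' ω = x}).toReal ≤ (P {ω | X₂ ω = x}).toReal ∧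
      (P {ω | X₂ ω = x}).toReal ≤ (P {ω | X₂' ω = x}).toReal + δ) :
    ∀ x ∈ S, 0 < x →
      (P {ω | max (X₁ ω) (X₂ ω) = x}).toReal - 2 * δ
        ≤ (P {ω | max (X₁' ω) (X₂' ω) = x}).toReal := by
  intro x hxS hx
  change P.real _ - 2 * δ ≤ P.real _
  rw [hind.measureReal_max_eq hm1 hm2, hind'.measureReal_max_eq hm1' hm2']
  have hlt : P.real (X₁ ⁻¹' Set.Iio x) ≤ P.real (X₁' ⁻¹' Set.Iio x) := by
    rw [← Set.compl_Ici]
    exact measureReal_preimage_compl_le_of_atoms_le hm1 hm1' hv1 hv1' measurableSet_Ici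
      fun y hyS hy => (hpmf1 y hyS (hx.trans_le hy)).1
  have hle : P.real (X₂ ⁻¹' Set.Iic x) ≤ P.real (X₂' ⁻¹' Set.Iic x) := by
    rw [← Set.compl_Ioi]
    exact measureReal_preimage_compl_le_of_atoms_le hm2 hm2' hv2 hv2' measurableSet_Ioi
      fun y hyS hy => (hpmf2 y hyS (hx.trans hy)).1
  have h1 : P.real (X₁ ⁻¹' {x}) ≤ P.real (X₁' ⁻¹' {x}) + δ := (hpmf1 x hxS hx).2
  have h2 : P.real (X₂ ⁻¹' {x}) ≤ P.real (X₂' ⁻¹' {x}) + δ := (hpmf2 x hxS hx).2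
  have e1 : P.real (X₁ ⁻¹' {x}) * P.real (X₂ ⁻¹' Set.Iic x) ≤
      P.real (X₁' ⁻¹' {x}) * P.real (X₂' ⁻¹' Set.Iic x) + δ := calc
    _ ≤ (P.real (X₁' ⁻¹' {x}) + δ) * P.real (X₂ ⁻¹' Set.Iic x) := by gcongr
    _ = P.real (X₁' ⁻¹' {x}) * P.real (X₂ ⁻¹' Set.Iic x) +
        δ * P.real (X₂ ⁻¹' Set.Iic x) := add_mul ..
    _ ≤ _ := by
      gcongr
      exact mul_le_of_le_one_right hδ measureReal_le_one
  have e2 : P.real (X₁ ⁻¹' Set.Iio x) * P.real (X₂ ⁻¹' {x}) ≤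
      P.real (X₁' ⁻¹' Set.Iio x) * P.real (X₂' ⁻¹' {x}) + δ := calc
    _ ≤ P.real (X₁ ⁻¹' Set.Iio x) * (P.real (X₂' ⁻¹' {x}) + δ) := by gcongr
    _ = P.real (X₁ ⁻¹' Set.Iio x) * P.real (X₂' ⁻¹' {x}) +
        P.real (X₁ ⁻¹' Set.Iio x) * δ := mul_add ..
    _ ≤ _ := by
      gcongr
      exact mul_le_of_le_one_left hδ measureReal_le_one
  linarith
end
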